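/- Let V₁,…,V_r and W₁,…,W_s be finite-dimensional complex vector spaces with dim V_i = m_i and dim W_j = n_j, and let A = ⊕_{i=1}^r End(V_i) and B = ⊕_{j=1}^s End(W_j). Let L be a finite-dimensional complex vector space equipped with a right A-module structure and a left B-module structure which commute with each other, containing A and B as vector subspaces in such a way that the right A-action restricted to A is right multiplication in A and the left B-action restricted to B is left multiplication in B, and suppose dim L = 2·dim A = 2·dim B. Suppose further that L carries a nondegenerate symmetric bilinear form with (v, a₁a₂) = (v a₁, a₂), (b₁b₂, v) = (b₁, b₂v), (a₁, a₂) = 0 and (b₁, b₂) = 0 for all v ∈ L, a₁, a₂ ∈ A and b₁, b₂ ∈ B. Then there exist nonnegative integers a_{ij} (1 ≤ i ≤ r, 1 ≤ j ≤ s) such that L is isomorphic as a (B,A)-bimodule to ⊕_{i,j} (V_i^* ⊗ W_j)^{a_{ij}} (with End(W_j) acting on the left on the factor W_j and End(V_i) acting on the right on the factor V_i^*, the other summands of A and B acting by zero), and moreover Σ_{j=1}^s a_{ij} n_j = 2m_i for every i and Σ_{i=1}^r a_{ij} m_i = 2n_j for every j. -/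

import Mathlib

open TensorProduct

section IdempotentDimension

variable {K : Type*} [Field K]

theorem LinearMap.exists_biorthogonal_of_idempotent {L : Type*} [AddCommGroup L] [Module K L]
    [FiniteDimensional K L] (P : L →ₗ[K] L) (hP : ∀ l, P (P l) = P l) :
    ∃ (n : ℕ) (μ : Fin n → L) (κ : Fin n → Module.Dual K L),
      (∀ l, ∑ k, κ k l • μ k = P l) ∧ ∀ k k', κ k (μ k') = if k = k' then 1 else 0 := by
  let b := Module.finBasis K (LinearMap.range P)
  refine ⟨_, fun k => (b k : L), fun k => b.coord k ∘ₗ P.rangeRestrict, fun l => ?_,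
    fun k k' => ?_⟩
  · have := congrArg Subtype.val (b.sum_repr (P.rangeRestrict l))
    rwa [Submodule.coe_sum] at this
  · have h : P.rangeRestrict (b k' : L) = b k' := by
      obtain ⟨l, hl⟩ := (b k').2
      ext
      simp [← hl, hP]
    simp [h, Finsupp.single_apply, eq_comm]

theorem Module.exists_dual_smul_eq_self (V : Type*) [AddCommGroup V] [Module K V] :
    ∃ (v : V) (f : Module.Dual K V), ∀ x : V, f v • x = x := by
  rcases subsingleton_or_nontrivial V with h | h
  · exact ⟨0, 0, fun x => Subsingleton.elim _ _⟩
  · obtain ⟨v, hv⟩ := exists_ne (0 : V)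
    obtain ⟨f, hf⟩ := Module.Projective.exists_dual_ne_zero K hv
    exact ⟨(f v)⁻¹ • v, f, fun x => by simp [hf]⟩

theorem LinearMap.BilinForm.two_mul_finrank_le_finrank_range {L M : Type*} [AddCommGroup L]
    [Module K L] [FiniteDimensional K L] [AddCommGroup M] [Module K M] [FiniteDimensional K M]
    (Bf : L →ₗ[K] L →ₗ[K] K) (hsymm : ∀ v w, Bf v w = Bf w v)
    (hnd : ∀ v, (∀ w, Bf v w = 0) → v = 0)
    (j : M →ₗ[K] L) (hj : Function.Injective j) (R : L →ₗ[K] L) (hRj : ∀ y, R (j y) = j y)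
    (hR : ∀ v y, Bf (R v) (j y) = Bf v (j y)) (hjj : ∀ x y, Bf (j x) (j y) = 0) :
    2 * Module.finrank K M ≤ Module.finrank K (LinearMap.range R) := by
  let f : M →ₗ[K] LinearMap.range R := j.codRestrict _ fun y => ⟨j y, hRj y⟩
  have hf : Function.Injective f := fun x y h => hj (congrArg Subtype.val h)
  let φ : L →ₗ[K] Module.Dual K M := (Bf ∘ₗ j).flip
  have hφ : Function.Surjective φ := by
    have h1 : Function.Injective (Bf ∘ₗ j) :=
      ((injective_iff_map_eq_zero Bf).2 fun v hv => hnd v fun w => by simp [hv]).comp hj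
    exact LinearMap.flip_surjective_iff₁.mpr h1
  let g : LinearMap.range R →ₗ[K] Module.Dual K M := φ ∘ₗ (LinearMap.range R).subtype
  have hg : Function.Surjective g := fun d => by
    obtain ⟨v, rfl⟩ := hφ d
    refine ⟨⟨R v, v, rfl⟩, ?_⟩
    ext y
    simp [g, φ, hsymm (j y), hR]
  have hle : LinearMap.range f ≤ LinearMap.ker g := by
    rintro _ ⟨x, rfl⟩
    ext y
    exact hjj y x
  have h1 := Submodule.finrank_mono hle
  rw [LinearMap.finrank_range_of_inj hf] at h1
  have h2 := LinearMap.finrank_range_add_finrank_ker g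
  rw [LinearMap.range_eq_top.2 hg, finrank_top, Subspace.dual_finrank_eq] at h2
  omega

end IdempotentDimension

section Decomposition

variable {K : Type*} [Field K]

theorem Pi.single_finsetSum {ι β : Type*} [DecidableEq ι] {M : ι → Type*}
    [∀ i, AddCommMonoid (M i)] (s : Finset β) (i : ι) (f : β → M i) :
    Pi.single i (∑ k ∈ s, f k) = ∑ k ∈ s, Pi.single i (f k) :=
  map_sum (AddMonoidHom.single M i) f s

/-- The rank one endomorphism `y ↦ f y • x` of `V i`, as an element of `∏ i, End (V i)`. -/
def piRankOne {ι : Type*} [DecidableEq ι] (V : ι → Type*) [∀ i, AddCommGroup (V i)]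
    [∀ i, Module K (V i)] (i : ι) :
    Module.Dual K (V i) →ₗ[K] V i →ₗ[K] ∀ i, Module.End K (V i) :=
  LinearMap.smulRightₗ.compr₂ (LinearMap.single K (fun i => Module.End K (V i)) i)

section PiRankOne

variable {ι : Type*} [DecidableEq ι] {V : ι → Type*} [∀ i, AddCommGroup (V i)]
  [∀ i, Module K (V i)]

theorem piRankOne_apply (i : ι) (f : Module.Dual K (V i)) (x : V i) :
    piRankOne V i f x = Pi.single i (f.smulRight x) := rfl

theorem mul_piRankOne (a : ∀ i, Module.End K (V i)) (i : ι) (f : Module.Dual K (V i)) (x : V i) :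
    a * piRankOne V i f x = piRankOne V i f (a i x) := by
  simp only [piRankOne_apply, ← Pi.single_mul_right]
  congr 1
  ext y
  simp

theorem piRankOne_mul (a : ∀ i, Module.End K (V i)) (i : ι) (f : Module.Dual K (V i)) (x : V i) :
    piRankOne V i f x * a = piRankOne V i ((a i).dualMap f) x := by
  simp only [piRankOne_apply, ← Pi.single_mul_left]
  congr 1

theorem piRankOne_mul_self (i : ι) (f f' : Module.Dual K (V i)) (x x' : V i) :
    piRankOne V i f x * piRankOne V i f' x' = f x' • piRankOne V i f' x := by
  rw [mul_piRankOne]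
  simp [piRankOne_apply]

theorem piRankOne_mul_of_ne {i i' : ι} (h : i ≠ i') (f : Module.Dual K (V i))
    (f' : Module.Dual K (V i')) (x : V i) (x' : V i') :
    piRankOne V i f x * piRankOne V i' f' x' = 0 := by
  rw [mul_piRankOne]
  simp [piRankOne_apply, Pi.single_eq_of_ne h.symm]

theorem sum_piRankOne_basis [Fintype ι] {β : ι → Type*} [∀ i, Fintype (β i)]
    (b : ∀ i, Module.Basis (β i) K (V i)) :
    ∑ i, ∑ k, piRankOne V i ((b i).coord k) (b i k) = 1 := by
  simp only [piRankOne_apply, ← Pi.single_finsetSum, Finset.univ_sum_single]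
  ext i y
  simp [LinearMap.sum_apply, Module.Basis.sum_repr]

end PiRankOne

theorem Module.Basis.sum_smul_coord_tmul {V W β γ : Type*} [AddCommGroup V] [Module K V]
    [AddCommGroup W] [Module K W] [Fintype β] [Fintype γ] (b : Module.Basis β K V)
    (c : Module.Basis γ K W) (φ : Module.Dual K V) (y : W) :
    ∑ p, ∑ q, (φ (b p) * c.coord q y) • (b.coord p ⊗ₜ[K] c q) = φ ⊗ₜ[K] y := by
  conv_rhs => rw [← b.sum_dual_apply_smul_coord φ, ← c.sum_repr y]
  simp only [TensorProduct.sum_tmul, TensorProduct.tmul_sum, TensorProduct.smul_tmul_smul,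
    Module.Basis.coord_apply]
  exact Finset.sum_comm

variable {ι κ : Type*} [Fintype ι] [DecidableEq ι] [Fintype κ] [DecidableEq κ]
  {V : ι → Type*} {W : κ → Type*}
  [∀ i, AddCommGroup (V i)] [∀ i, Module K (V i)] [∀ i, FiniteDimensional K (V i)]
  [∀ j, AddCommGroup (W j)] [∀ j, Module K (W j)] [∀ j, FiniteDimensional K (W j)]
  {L : Type*} [AddCommGroup L] [Module K L] [FiniteDimensional K L]

theorem exists_bimodule_decomposition
    (act : L →ₗ[K] (∀ i, Module.End K (V i)) →ₗ[K] L)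
    (hact : ∀ (v : L) (x y : ∀ i, Module.End K (V i)), act (act v x) y = act v (x * y))
    (hact1 : ∀ v : L, act v 1 = v)
    (lact : (∀ j, Module.End K (W j)) →ₗ[K] L →ₗ[K] L)
    (hlact : ∀ (x y : ∀ j, Module.End K (W j)) (v : L), lact x (lact y v) = lact (x * y) v)
    (hlact1 : ∀ v : L, lact 1 v = v)
    (hcomm : ∀ (x : ∀ j, Module.End K (W j)) (v : L) (y : ∀ i, Module.End K (V i)),
      act (lact x v) y = lact x (act v y)) :
    ∃ (a : ι → κ → ℕ)
      (e : L ≃ₗ[K] (∀ i j, Fin (a i j) → (Module.Dual K (V i) ⊗[K] W j))),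
      (∀ (v : L) (x : ∀ i, Module.End K (V i)),
        e (act v x) = fun i j k => TensorProduct.map (x i).dualMap LinearMap.id (e v i j k)) ∧
      (∀ (x : ∀ j, Module.End K (W j)) (v : L),
        e (lact x v) = fun i j k => TensorProduct.map LinearMap.id (x j) (e v i j k)) ∧
      (∀ i j, Subsingleton (V i) ∨ Subsingleton (W j) → a i j = 0) := by
  choose v f hfv using fun i => Module.exists_dual_smul_eq_self (K := K) (V i)
  choose w g hgw using fun j => Module.exists_dual_smul_eq_self (K := K) (W j)
  let P : ∀ i j, L →ₗ[K] L := fun i j =>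
    lact (piRankOne W j (g j) (w j)) ∘ₗ act.flip (piRankOne V i (f i) (v i))
  have hP : ∀ i j l, P i j l =
      lact (piRankOne W j (g j) (w j)) (act l (piRankOne V i (f i) (v i))) := fun _ _ _ => rfl
  have hPP : ∀ i j (ψ : Module.Dual K (W j)) (x : V i) l,
      P i j (lact (piRankOne W j ψ (w j)) (act l (piRankOne V i (f i) x))) =
        lact (piRankOne W j ψ (w j)) (act l (piRankOne V i (f i) x)) := by
    intro i j ψ x l
    simp only [hP, hcomm, hact, hlact, piRankOne_mul_self]
    rw [← map_smul (piRankOne W j ψ), hgw, ← map_smul (piRankOne V i (f i)), hfv]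
  choose a μ c hμ hcμ using fun i j =>
    LinearMap.exists_biorthogonal_of_idempotent (P i j) fun l => hPP i j _ _ l
  have hPμ : ∀ i j k, P i j (μ i j k) = μ i j k := fun i j k => by
    simp [← hμ, hcμ]
  have T : ∀ i j (k : Fin (a i j)), ∃ T : (Module.Dual K (V i) ⊗[K] W j) →ₗ[K] L,
      ∀ φ y, T (φ ⊗ₜ y) = lact (piRankOne W j (g j) y) (act (μ i j k) (piRankOne V i φ (v i))) :=
    fun i j k => ⟨TensorProduct.lift (LinearMap.mk₂ K (fun φ y =>
      lact (piRankOne W j (g j) y) (act (μ i j k) (piRankOne V i φ (v i))))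
      (by simp) (by simp) (by simp) (by simp)), fun φ y => by simp⟩
  choose T hT using T
  let Ψ : (∀ i j, Fin (a i j) → (Module.Dual K (V i) ⊗[K] W j)) →ₗ[K] L :=
    ∑ i, ∑ j, ∑ k, T i j k ∘ₗ LinearMap.proj k ∘ₗ LinearMap.proj j ∘ₗ LinearMap.proj i
  have hΨ : ∀ t, Ψ t = ∑ i, ∑ j, ∑ k, T i j k (t i j k) := fun t => by
    simp [Ψ, LinearMap.sum_apply]
  let bV := fun i => Module.finBasis K (V i)
  let bW := fun j => Module.finBasis K (W j)
  let Φ : L →ₗ[K] (∀ i j, Fin (a i j) → (Module.Dual K (V i) ⊗[K] W j)) :=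
    LinearMap.pi fun i => LinearMap.pi fun j => LinearMap.pi fun k => ∑ p, ∑ q,
      ((c i j k) ∘ₗ lact (piRankOne W j ((bW j).coord q) (w j)) ∘ₗ
        act.flip (piRankOne V i (f i) (bV i p))).smulRight ((bV i).coord p ⊗ₜ bW j q)
  have hΦ : ∀ l i j k, Φ l i j k = ∑ p, ∑ q, c i j k (lact (piRankOne W j ((bW j).coord q) (w j))
      (act l (piRankOne V i (f i) (bV i p)))) • ((bV i).coord p ⊗ₜ bW j q) := fun l i j k => by
    simp [Φ, LinearMap.sum_apply]
  have hΨΦ : ∀ l, Ψ (Φ l) = l := by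
    intro l
    have hX : ∀ i j p q, ∑ k, c i j k (lact (piRankOne W j ((bW j).coord q) (w j))
        (act l (piRankOne V i (f i) (bV i p)))) • lact (piRankOne W j (g j) (bW j q))
          (act (μ i j k) (piRankOne V i ((bV i).coord p) (v i))) =
        lact (piRankOne W j ((bW j).coord q) (bW j q))
          (act l (piRankOne V i ((bV i).coord p) (bV i p))) := by
      intro i j p q
      have h := congrArg (fun z => lact (piRankOne W j (g j) (bW j q))
        (act z (piRankOne V i ((bV i).coord p) (v i))))
        (hμ i j (lact (piRankOne W j ((bW j).coord q) (w j))
          (act l (piRankOne V i (f i) (bV i p)))))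
      simp only [map_sum, map_smul, LinearMap.sum_apply, LinearMap.smul_apply] at h
      rw [h, hPP, hcomm, hact, hlact, piRankOne_mul_self, piRankOne_mul_self,
        ← map_smul (piRankOne W j _), hgw, ← map_smul (piRankOne V i _), hfv]
    have hsum : ∀ i j, ∑ k, T i j k (Φ l i j k) =
        ∑ p, ∑ q, lact (piRankOne W j ((bW j).coord q) (bW j q))
          (act l (piRankOne V i ((bV i).coord p) (bV i p))) := by
      intro i j
      simp only [hΦ, map_sum, map_smul, hT]
      rw [Finset.sum_comm]
      refine Finset.sum_congr rfl fun p _ => ?_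
      rw [Finset.sum_comm]
      exact Finset.sum_congr rfl fun q _ => hX i j p q
    have hW : ∀ z, ∑ j, ∑ q, lact (piRankOne W j ((bW j).coord q) (bW j q)) z = z := fun z => by
      simp only [← LinearMap.sum_apply, ← map_sum lact, sum_piRankOne_basis, hlact1]
    have hV : ∑ i, ∑ p, act l (piRankOne V i ((bV i).coord p) (bV i p)) = l := by
      simp only [← map_sum (act l), sum_piRankOne_basis, hact1]
    simp only [hΨ, hsum]
    conv_rhs => rw [← hV]
    refine Finset.sum_congr rfl fun i _ => ?_
    rw [Finset.sum_comm]
    exact Finset.sum_congr rfl fun p _ => hW _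
  have hΦT : ∀ i j k t, Φ (T i j k t) = Pi.single i (Pi.single j (Pi.single k t)) := by
    intro i j k t
    induction t with
    | zero => simp
    | add t t' h h' => simp [h, h', Pi.single_add]
    | tmul φ y =>
      ext i' j' k'
      rw [hΦ, hT]
      simp only [hcomm, hact, hlact]
      rcases eq_or_ne i i' with rfl | hi
      · rcases eq_or_ne j j' with rfl | hj
        · simp only [piRankOne_mul_self, map_smul, LinearMap.smul_apply, ← hP, hPμ, hcμ]
          rcases eq_or_ne k k' with rfl | hk
          · simp only [Pi.single_eq_same, if_true, smul_eq_mul, mul_one]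
            rw [← Module.Basis.sum_smul_coord_tmul (bV i) (bW j) φ y]
          · simp [hk.symm]
        · simp [piRankOne_mul_of_ne hj.symm, Pi.single_eq_of_ne hj.symm]
      · simp [piRankOne_mul_of_ne hi, Pi.single_eq_of_ne hi.symm]
  have hΦΨ : ∀ t, Φ (Ψ t) = t := by
    intro t
    simp only [hΨ, map_sum, hΦT]
    simp only [← Pi.single_finsetSum, Finset.univ_sum_single]
  have hTact : ∀ i j k t x, act (T i j k t) x =
      T i j k (TensorProduct.map (x i).dualMap LinearMap.id t) := by
    intro i j k t x
    induction t with
    | zero => simp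
    | add t t' h h' => simp [h, h']
    | tmul φ y => simp [hT, hcomm, hact, piRankOne_mul]
  have hTlact : ∀ i j k t x, lact x (T i j k t) =
      T i j k (TensorProduct.map LinearMap.id (x j) t) := by
    intro i j k t x
    induction t with
    | zero => simp
    | add t t' h h' => simp [h, h']
    | tmul φ y => simp [hT, hlact, mul_piRankOne]
  refine ⟨a, LinearEquiv.ofLinearMap Φ Ψ (LinearMap.ext hΦΨ) (LinearMap.ext hΨΦ), fun l x => ?_,
    fun x l => ?_, fun i j h => ?_⟩
  · simp only [LinearEquiv.coe_ofLinearMap]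
    rw [← hΦΨ (fun i j k => _)]
    congr 1
    conv_lhs => rw [← hΨΦ l]
    simp only [hΨ, map_sum, LinearMap.sum_apply, hTact]
  · simp only [LinearEquiv.coe_ofLinearMap]
    rw [← hΦΨ (fun i j k => _)]
    congr 1
    conv_lhs => rw [← hΨΦ l]
    simp only [hΨ, map_sum, hTlact]
  · by_contra hne
    let k : Fin (a i j) := ⟨0, Nat.pos_of_ne_zero hne⟩
    have h0 : μ i j k = 0 := by
      rw [← hPμ, hP]
      rcases h with h | h
      · simp [Subsingleton.elim (v i) 0]
      · simp [Subsingleton.elim (w j) 0]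
    simpa [h0] using hcμ i j k k

end Decomposition

/-- Lemma 4.2: for semi-simple `A = ⊕ᵢ End(Vᵢ)` and `B = ⊕ⱼ End(Wⱼ)` acting on `L`
on the right and on the left respectively (commuting actions), with `A, B ⊆ L`
extending the regular actions, `dim L = 2·dim A = 2·dim B`, and a nondegenerate
symmetric invariant bilinear form vanishing on `A` and on `B`, the bimodule `L` is
isomorphic to `⊕_{i,j} (Vᵢ* ⊗ Wⱼ)^{a_{ij}}` with `Σⱼ a_{ij}nⱼ = 2mᵢ` and
`Σᵢ a_{ij}mᵢ = 2nⱼ`. -/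
theorem stmt_18 (r s : ℕ) (hr : 1 ≤ r) (hs : 1 ≤ s)
    (V : Fin r → Type*) (W : Fin s → Type*)
    [∀ i, AddCommGroup (V i)] [∀ i, Module ℂ (V i)] [∀ i, FiniteDimensional ℂ (V i)]
    [∀ j, AddCommGroup (W j)] [∀ j, Module ℂ (W j)] [∀ j, FiniteDimensional ℂ (W j)]
    (mdim : Fin r → ℕ) (hmdim : ∀ i, Module.finrank ℂ (V i) = mdim i)
    (ndim : Fin s → ℕ) (hndim : ∀ j, Module.finrank ℂ (W j) = ndim j)
    (L : Type*) [AddCommGroup L] [Module ℂ L] [FiniteDimensional ℂ L]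
    (act : L →ₗ[ℂ] (∀ i, Module.End ℂ (V i)) →ₗ[ℂ] L)
    (hact : ∀ (v : L) (x y : ∀ i, Module.End ℂ (V i)), act (act v x) y = act v (x * y))
    (hact1 : ∀ v : L, act v 1 = v)
    (lact : (∀ j, Module.End ℂ (W j)) →ₗ[ℂ] L →ₗ[ℂ] L)
    (hlact : ∀ (x y : ∀ j, Module.End ℂ (W j)) (v : L), lact x (lact y v) = lact (x * y) v)
    (hlact1 : ∀ v : L, lact 1 v = v)
    (hcomm : ∀ (x : ∀ j, Module.End ℂ (W j)) (v : L) (y : ∀ i, Module.End ℂ (V i)),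
      act (lact x v) y = lact x (act v y))
    (ιA : (∀ i, Module.End ℂ (V i)) →ₗ[ℂ] L) (hιA : Function.Injective ιA)
    (hιAact : ∀ x y : ∀ i, Module.End ℂ (V i), act (ιA x) y = ιA (x * y))
    (ιB : (∀ j, Module.End ℂ (W j)) →ₗ[ℂ] L) (hιB : Function.Injective ιB)
    (hιBact : ∀ x y : ∀ j, Module.End ℂ (W j), lact x (ιB y) = ιB (x * y))
    (hdimA : Module.finrank ℂ L = 2 * Module.finrank ℂ (∀ i, Module.End ℂ (V i)))
    (hdimB : Module.finrank ℂ L = 2 * Module.finrank ℂ (∀ j, Module.End ℂ (W j)))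
    (Bf : L →ₗ[ℂ] L →ₗ[ℂ] ℂ)
    (hsymm : ∀ v w : L, Bf v w = Bf w v)
    (hnd : ∀ v : L, (∀ w, Bf v w = 0) → v = 0)
    (hinvA : ∀ (v : L) (x y : ∀ i, Module.End ℂ (V i)),
      Bf v (ιA (x * y)) = Bf (act v x) (ιA y))
    (hinvB : ∀ (x y : ∀ j, Module.End ℂ (W j)) (v : L),
      Bf (ιB (x * y)) v = Bf (ιB x) (lact y v))
    (hAA : ∀ x y : ∀ i, Module.End ℂ (V i), Bf (ιA x) (ιA y) = 0)
    (hBB : ∀ x y : ∀ j, Module.End ℂ (W j), Bf (ιB x) (ιB y) = 0) :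
    ∃ (a : Fin r → Fin s → ℕ)
      (e : L ≃ₗ[ℂ] (∀ i j, Fin (a i j) → (Module.Dual ℂ (V i) ⊗[ℂ] W j))),
      (∀ (v : L) (x : ∀ i, Module.End ℂ (V i)),
        e (act v x) = fun i j k => TensorProduct.map (x i).dualMap LinearMap.id (e v i j k)) ∧
      (∀ (x : ∀ j, Module.End ℂ (W j)) (v : L),
        e (lact x v) = fun i j k => TensorProduct.map LinearMap.id (x j) (e v i j k)) ∧
      (∀ i, ∑ j, a i j * ndim j = 2 * mdim i) ∧
      (∀ j, ∑ i, a i j * mdim i = 2 * ndim j) := by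
  obtain ⟨a, e, he, he', ha0⟩ := exists_bimodule_decomposition act hact hact1 lact hlact hlact1 hcomm
  refine ⟨a, e, he, he', ?_⟩
  have hdim : Module.finrank ℂ L = ∑ i, ∑ j, a i j * (mdim i * ndim j) := by
    rw [e.finrank_eq]
    simp [Module.finrank_pi_fintype, hmdim, hndim]
  have hA : ∀ i, 2 * (mdim i * mdim i) ≤ ∑ j, a i j * (mdim i * ndim j) := by
    intro i
    let p : ∀ i, Module.End ℂ (V i) := Pi.single i 1
    have hp : ∀ y, p * Pi.single i y = Pi.single i y := fun y => by
      simp [p, ← Pi.single_mul]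
    have h1 := LinearMap.BilinForm.two_mul_finrank_le_finrank_range Bf hsymm hnd
      (ιA ∘ₗ LinearMap.single ℂ (fun i => Module.End ℂ (V i)) i)
      (hιA.comp (Pi.single_injective (M := fun i => Module.End ℂ (V i)) i)) (act.flip p)
      (fun y => by simp [hιAact, p, ← Pi.single_mul])
      (fun v y => by simp [← hinvA, hp]) (fun x y => hAA _ _)
    let F : LinearMap.range (act.flip p) →ₗ[ℂ] ∀ j, Fin (a i j) → (Module.Dual ℂ (V i) ⊗[ℂ] W j) :=
      LinearMap.proj i ∘ₗ e.toLinearMap ∘ₗ Submodule.subtype _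
    have hF : Function.Injective F := by
      rw [injective_iff_map_eq_zero]
      rintro ⟨_, v, rfl⟩ h
      ext
      refine e.injective ?_
      ext i' j k
      rcases eq_or_ne i' i with rfl | hi
      · simpa [F] using congrFun (congrFun h j) k
      · have h0 : (0 : Module.End ℂ (V i')).dualMap = 0 := map_zero (Module.Dual.transpose (R := ℂ))
        simp [he, p, Pi.single_eq_of_ne hi, h0]
    have h2 := LinearMap.finrank_le_finrank_of_injective hF
    simp only [Module.finrank_pi_fintype, Module.finrank_linearMap, hmdim, hndim,
      Module.finrank_tensorProduct] at h1 h2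
    simpa using h1.trans h2
  have hB : ∀ j, 2 * (ndim j * ndim j) ≤ ∑ i, a i j * (mdim i * ndim j) := by
    intro j
    let p : ∀ j, Module.End ℂ (W j) := Pi.single j 1
    have hp : ∀ y, Pi.single j y * p = Pi.single j y := fun y => by
      simp [p, ← Pi.single_mul]
    have h1 := LinearMap.BilinForm.two_mul_finrank_le_finrank_range Bf hsymm hnd
      (ιB ∘ₗ LinearMap.single ℂ (fun j => Module.End ℂ (W j)) j)
      (hιB.comp (Pi.single_injective (M := fun j => Module.End ℂ (W j)) j)) (lact p)
      (fun y => by simp [hιBact, p, ← Pi.single_mul])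
      (fun v y => by simp [hsymm _ (ιB _), ← hinvB, hp]) (fun x y => hBB _ _)
    let F : LinearMap.range (lact p) →ₗ[ℂ] ∀ i, Fin (a i j) → (Module.Dual ℂ (V i) ⊗[ℂ] W j) :=
      (LinearMap.pi fun i => LinearMap.proj j ∘ₗ LinearMap.proj i) ∘ₗ
        e.toLinearMap ∘ₗ Submodule.subtype _
    have hF : Function.Injective F := by
      rw [injective_iff_map_eq_zero]
      rintro ⟨_, v, rfl⟩ h
      ext
      refine e.injective ?_
      ext i j' k
      rcases eq_or_ne j' j with rfl | hj
      · simpa [F] using congrFun (congrFun h i) k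
      · simp [he', p, Pi.single_eq_of_ne hj]
    have h2 := LinearMap.finrank_le_finrank_of_injective hF
    simp only [Module.finrank_pi_fintype, Module.finrank_linearMap, hmdim, hndim,
      Module.finrank_tensorProduct] at h1 h2
    simpa using h1.trans h2
  simp only [Module.finrank_pi_fintype, Module.finrank_linearMap, hmdim, hndim, hdim,
    Finset.mul_sum] at hdimA hdimB
  rw [Finset.sum_comm] at hdimB
  have hA' := (Finset.sum_eq_sum_iff_of_le fun i _ => hA i).1 hdimA.symm
  have hB' := (Finset.sum_eq_sum_iff_of_le fun j _ => hB j).1 hdimB.symm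
  constructor
  · intro i
    rcases (mdim i).eq_zero_or_pos with h | h
    · have : Subsingleton (V i) := Module.finrank_zero_iff.1 ((hmdim i).trans h)
      simp [h, ha0 i _ (Or.inl this)]
    · refine Nat.eq_of_mul_eq_mul_left h ?_
      rw [Finset.mul_sum, mul_left_comm, hA' i (Finset.mem_univ i)]
      exact Finset.sum_congr rfl fun j _ => by ring
  · intro j
    rcases (ndim j).eq_zero_or_pos with h | h
    · have : Subsingleton (W j) := Module.finrank_zero_iff.1 ((hndim j).trans h)
      simp [h, ha0 _ j (Or.inr this)]
    · refine Nat.eq_of_mul_eq_mul_left h ?_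
      rw [Finset.mul_sum, mul_left_comm, hB' j (Finset.mem_univ j)]
      exact Finset.sum_congr rfl fun i _ => by ring
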